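/- arXiv:2501.12510 — 3 statements merged into one kernel-verified Lean document; each statement's English description precedes it below -/
import Mathlib

section
/- Let J : 𝒜 → ℰ be a pseudofunctor between bicategories and let T be a J-relative pseudomonad. The T-pseudoalgebras, lax morphisms of T-pseudoalgebras, and transformations form a bicategory PsAlg_l(T): hom-categories are the categories of lax morphisms and transformations (with vertical composition that of ℰ); the identity on (A, (-)^a, â, ã) is 1_A equipped with the canonical invertible 2-cells (1_A f)^a ≅ f^a ≅ 1_A f^a; the composite of lax morphisms (h, h̄) : (A,...) → (B,...) and (h', h̄') : (B,...) → (C, (-)^c, ĉ, c̃) is h'h equipped with the 2-cells ((h'h)f)^c ≅ (h'(hf))^c ⇒ h'(hf)^b ⇒ h'(h f^a) ≅ (h'h) f^a built from h̄'_{hf} and h'h̄_f; horizontal composition of transformations is that of ℰ; and the associators and unitors of ℰ are transformations, providing the structural isomorphisms of PsAlg_l(T). -/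
open CategoryTheory Bicategory

universe w₁ v₁ u₁ w₂ v₂ u₂

section RelPsMnd

variable {𝒜 : Type u₁} [Bicategory.{w₁, v₁} 𝒜] {ℰ : Type u₂} [Bicategory.{w₂, v₂} ℰ]

/-- Precomposition with a fixed 1-cell, as a functor between hom-categories. -/
@[simps]
def precompF {a b : ℰ} (c : ℰ) (f : a ⟶ b) : (b ⟶ c) ⥤ (a ⟶ c) where
  obj g := f ≫ g
  map η := f ◁ η

/-- A pseudomonad relative to a pseudofunctor `J : 𝒜 ⥤ ℰ`, given in extension form:
an object assignment, extension operators, units, and invertible coherence 2-cells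
`mul` (μ), `eta` (η), `theta` (θ) subject to associativity and unit laws. -/
structure RelativePseudomonad (J : Pseudofunctor 𝒜 ℰ) where
  obj : 𝒜 → ℰ
  unit : ∀ X : 𝒜, J.obj X ⟶ obj X
  ext : ∀ {X Y : 𝒜}, (J.obj X ⟶ obj Y) ⥤ (obj X ⟶ obj Y)
  mul : ∀ {X Y Z : 𝒜} (f : J.obj X ⟶ obj Y) (g : J.obj Y ⟶ obj Z),
    ext.obj (f ≫ ext.obj g) ≅ ext.obj f ≫ ext.obj g
  eta : ∀ {X Y : 𝒜} (f : J.obj X ⟶ obj Y), f ≅ unit X ≫ ext.obj f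
  theta : ∀ X : 𝒜, ext.obj (unit X) ≅ 𝟙 (obj X)
  mul_natural : ∀ {X Y Z : 𝒜} {f f' : J.obj X ⟶ obj Y} {g g' : J.obj Y ⟶ obj Z}
    (α : f ⟶ f') (β : g ⟶ g'),
    ext.map (α ▷ ext.obj g ≫ f' ◁ ext.map β) ≫ (mul f' g').hom =
      (mul f g).hom ≫ (ext.map α ▷ ext.obj g ≫ ext.obj f' ◁ ext.map β)
  eta_natural : ∀ {X Y : 𝒜} {f f' : J.obj X ⟶ obj Y} (α : f ⟶ f'),
    α ≫ (eta f').hom = (eta f).hom ≫ unit X ◁ ext.map α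
  assoc : ∀ {W X Y Z : 𝒜} (f : J.obj W ⟶ obj X) (g : J.obj X ⟶ obj Y)
    (h : J.obj Y ⟶ obj Z),
    (mul f (g ≫ ext.obj h)).hom ≫ ext.obj f ◁ (mul g h).hom =
      ext.map (f ◁ (mul g h).hom) ≫ ext.map (α_ f (ext.obj g) (ext.obj h)).inv ≫
        (mul (f ≫ ext.obj g) h).hom ≫ (mul f g).hom ▷ ext.obj h ≫
        (α_ (ext.obj f) (ext.obj g) (ext.obj h)).hom
  unit_law : ∀ {X Y : 𝒜} (f : J.obj X ⟶ obj Y),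
    ext.map (eta f).hom ≫ (mul (unit X) f).hom ≫ (theta X).hom ▷ ext.obj f =
      (λ_ (ext.obj f)).inv

namespace RelativePseudomonad

variable {J : Pseudofunctor 𝒜 ℰ} (T : RelativePseudomonad J)

/-- The data of a pseudoalgebra for a relative pseudomonad on a carrier `C`:
extension operators `ext`, associativity 2-cells `ahat` (â) and unit 2-cells `atil` (ã). -/
structure AlgData (C : ℰ) where
  ext : ∀ (X : 𝒜), (J.obj X ⟶ C) ⥤ (T.obj X ⟶ C)
  ahat : ∀ {X Y : 𝒜} (f : J.obj X ⟶ T.obj Y) (g : J.obj Y ⟶ C),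
    (ext X).obj (f ≫ (ext Y).obj g) ≅ T.ext.obj f ≫ (ext Y).obj g
  atil : ∀ {X : 𝒜} (f : J.obj X ⟶ C), f ≅ T.unit X ≫ (ext X).obj f

/-- The pseudoalgebra axioms. -/
structure AlgData.Laws {C : ℰ} (S : T.AlgData C) : Prop where
  ahat_natural : ∀ {X Y : 𝒜} {f f' : J.obj X ⟶ T.obj Y} {g g' : J.obj Y ⟶ C}
    (α : f ⟶ f') (β : g ⟶ g'),
    (S.ext X).map (α ▷ (S.ext Y).obj g ≫ f' ◁ (S.ext Y).map β) ≫ (S.ahat f' g').hom =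
      (S.ahat f g).hom ≫ (T.ext.map α ▷ (S.ext Y).obj g ≫ T.ext.obj f' ◁ (S.ext Y).map β)
  atil_natural : ∀ {X : 𝒜} {f f' : J.obj X ⟶ C} (α : f ⟶ f'),
    α ≫ (S.atil f').hom = (S.atil f).hom ≫ T.unit X ◁ (S.ext X).map α
  assoc : ∀ {W X Y : 𝒜} (f : J.obj W ⟶ T.obj X) (g : J.obj X ⟶ T.obj Y)
    (h : J.obj Y ⟶ C),
    (S.ahat f (g ≫ (S.ext Y).obj h)).hom ≫ T.ext.obj f ◁ (S.ahat g h).hom =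
      (S.ext W).map (f ◁ (S.ahat g h).hom) ≫
        (S.ext W).map (α_ f (T.ext.obj g) ((S.ext Y).obj h)).inv ≫
        (S.ahat (f ≫ T.ext.obj g) h).hom ≫ (T.mul f g).hom ▷ (S.ext Y).obj h ≫
        (α_ (T.ext.obj f) (T.ext.obj g) ((S.ext Y).obj h)).hom
  unit : ∀ {X : 𝒜} (f : J.obj X ⟶ C),
    (S.ext X).map (S.atil f).hom ≫ (S.ahat (T.unit X) f).hom ≫
      (T.theta X).hom ▷ (S.ext X).obj f = (λ_ ((S.ext X).obj f)).inv

/-- A pseudoalgebra: data together with the laws. -/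
structure Algebra (C : ℰ) extends AlgData T C where
  laws : toAlgData.Laws

/-- The data of the free pseudoalgebra on an object of `𝒜`. -/
@[simps]
def freeAlgData (X : 𝒜) : T.AlgData (T.obj X) where
  ext _ := T.ext
  ahat f g := T.mul f g
  atil f := T.eta f

theorem freeAlgData_laws (X : 𝒜) : (T.freeAlgData X).Laws where
  ahat_natural := T.mul_natural
  atil_natural := T.eta_natural
  assoc := T.assoc
  unit := T.unit_law

/-- The free pseudoalgebra on `X`. -/
def freeAlgebra (X : 𝒜) : T.Algebra (T.obj X) := ⟨T.freeAlgData X, T.freeAlgData_laws X⟩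

variable {T}

/-- The data of a lax morphism of pseudoalgebras: a 1-cell between the carriers
together with the comparison 2-cells `lax`. -/
structure LaxData {C C' : ℰ} (S : T.AlgData C) (S' : T.AlgData C') where
  hom : C ⟶ C'
  lax : ∀ (X : 𝒜) (f : J.obj X ⟶ C),
    (S'.ext X).obj (f ≫ hom) ⟶ (S.ext X).obj f ≫ hom

/-- The axioms for a lax morphism of pseudoalgebras. -/
structure LaxData.IsLaxMorphism {C C' : ℰ} {S : T.AlgData C} {S' : T.AlgData C'}
    (m : LaxData S S') : Prop where
  natural : ∀ {X : 𝒜} {f f' : J.obj X ⟶ C} (α : f ⟶ f'),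
    (S'.ext X).map (α ▷ m.hom) ≫ m.lax X f' = m.lax X f ≫ (S.ext X).map α ▷ m.hom
  unit : ∀ {X : 𝒜} (f : J.obj X ⟶ C),
    (S'.atil (f ≫ m.hom)).hom ≫ T.unit X ◁ m.lax X f =
      (S.atil f).hom ▷ m.hom ≫ (α_ (T.unit X) ((S.ext X).obj f) m.hom).hom
  assoc : ∀ {X Y : 𝒜} (f : J.obj X ⟶ T.obj Y) (g : J.obj Y ⟶ C),
    (S'.ahat f (g ≫ m.hom)).hom ≫ T.ext.obj f ◁ m.lax Y g ≫
        (α_ (T.ext.obj f) ((S.ext Y).obj g) m.hom).inv =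
      (S'.ext X).map (f ◁ m.lax Y g) ≫
        (S'.ext X).map (α_ f ((S.ext Y).obj g) m.hom).inv ≫
        m.lax X (f ≫ (S.ext Y).obj g) ≫ (S.ahat f g).hom ▷ m.hom

/-- Pseudomorphisms are lax morphisms whose comparison 2-cells are invertible. -/
def LaxData.IsPseudoMorphism {C C' : ℰ} {S : T.AlgData C} {S' : T.AlgData C'}
    (m : LaxData S S') : Prop :=
  m.IsLaxMorphism ∧ ∀ (X : 𝒜) (f : J.obj X ⟶ C), IsIso (m.lax X f)

/-- The data of a colax morphism of pseudoalgebras. -/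
structure ColaxData {C C' : ℰ} (S : T.AlgData C) (S' : T.AlgData C') where
  hom : C ⟶ C'
  colax : ∀ (X : 𝒜) (f : J.obj X ⟶ C),
    (S.ext X).obj f ≫ hom ⟶ (S'.ext X).obj (f ≫ hom)

/-- The axioms for a colax morphism of pseudoalgebras. -/
structure ColaxData.IsColaxMorphism {C C' : ℰ} {S : T.AlgData C} {S' : T.AlgData C'}
    (m : ColaxData S S') : Prop where
  natural : ∀ {X : 𝒜} {f f' : J.obj X ⟶ C} (α : f ⟶ f'),
    m.colax X f ≫ (S'.ext X).map (α ▷ m.hom) = (S.ext X).map α ▷ m.hom ≫ m.colax X f'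
  unit : ∀ {X : 𝒜} (f : J.obj X ⟶ C),
    (S.atil f).hom ▷ m.hom ≫ (α_ (T.unit X) ((S.ext X).obj f) m.hom).hom ≫
        T.unit X ◁ m.colax X f =
      (S'.atil (f ≫ m.hom)).hom
  assoc : ∀ {X Y : 𝒜} (f : J.obj X ⟶ T.obj Y) (g : J.obj Y ⟶ C),
    (S.ahat f g).hom ▷ m.hom ≫ (α_ (T.ext.obj f) ((S.ext Y).obj g) m.hom).hom ≫
        T.ext.obj f ◁ m.colax Y g =
      m.colax X (f ≫ (S.ext Y).obj g) ≫
        (S'.ext X).map (α_ f ((S.ext Y).obj g) m.hom).hom ≫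
        (S'.ext X).map (f ◁ m.colax Y g) ≫ (S'.ahat f (g ≫ m.hom)).hom

/-- A 2-cell between (the underlying 1-cells of) two lax morphisms is a transformation. -/
def IsTransformation {C C' : ℰ} {S : T.AlgData C} {S' : T.AlgData C'}
    (m m' : LaxData S S') (α : m.hom ⟶ m'.hom) : Prop :=
  ∀ (X : 𝒜) (f : J.obj X ⟶ C),
    (S'.ext X).map (f ◁ α) ≫ m'.lax X f = m.lax X f ≫ (S.ext X).obj f ◁ α

/-- A 2-cell between (the underlying 1-cells of) two colax morphisms is a transformation. -/
def IsColaxTransformation {C C' : ℰ} {S : T.AlgData C} {S' : T.AlgData C'}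
    (m m' : ColaxData S S') (α : m.hom ⟶ m'.hom) : Prop :=
  ∀ (X : 𝒜) (f : J.obj X ⟶ C),
    (S.ext X).obj f ◁ α ≫ m'.colax X f = m.colax X f ≫ (S'.ext X).map (f ◁ α)

/-- The identity lax morphism data, with the canonical comparison 2-cells
`(1 ∘ f)^a ≅ f^a ≅ 1 ∘ f^a`. -/
@[simps]
def idLaxData {C : ℰ} (S : T.AlgData C) : LaxData S S where
  hom := 𝟙 C
  lax X f := (S.ext X).map (ρ_ f).hom ≫ (ρ_ ((S.ext X).obj f)).inv

/-- The composite of two lax morphism data. -/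
@[simps]
def compLaxData {C C' C'' : ℰ} {S : T.AlgData C} {S' : T.AlgData C'} {S'' : T.AlgData C''}
    (m : LaxData S S') (m' : LaxData S' S'') : LaxData S S'' where
  hom := m.hom ≫ m'.hom
  lax X f :=
    (S''.ext X).map (α_ f m.hom m'.hom).inv ≫ m'.lax X (f ≫ m.hom) ≫
      m.lax X f ▷ m'.hom ≫ (α_ ((S.ext X).obj f) m.hom m'.hom).hom

/-- The identity colax morphism data. -/
@[simps]
def idColaxData {C : ℰ} (S : T.AlgData C) : ColaxData S S where
  hom := 𝟙 C
  colax X f := (ρ_ ((S.ext X).obj f)).hom ≫ (S.ext X).map (ρ_ f).inv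

/-- The composite of two colax morphism data. -/
@[simps]
def compColaxData {C C' C'' : ℰ} {S : T.AlgData C} {S' : T.AlgData C'} {S'' : T.AlgData C''}
    (m : ColaxData S S') (m' : ColaxData S' S'') : ColaxData S S'' where
  hom := m.hom ≫ m'.hom
  colax X f :=
    (α_ ((S.ext X).obj f) m.hom m'.hom).inv ≫ m.colax X f ▷ m'.hom ≫
      m'.colax X (f ≫ m.hom) ≫ (S''.ext X).map (α_ f m.hom m'.hom).hom

/-- Morphisms of pseudoalgebras satisfying a property `P` (e.g. lax morphisms,
pseudomorphisms), which form a category under transformations. -/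
def Mor {C C' : ℰ} (S : T.AlgData C) (S' : T.AlgData C') (P : LaxData S S' → Prop) :=
  { m : LaxData S S' // P m }

instance morCategory {C C' : ℰ} (S : T.AlgData C) (S' : T.AlgData C')
    (P : LaxData S S' → Prop) : Category (Mor S S' P) where
  Hom m m' := { α : m.val.hom ⟶ m'.val.hom // IsTransformation m.val m'.val α }
  id m := ⟨𝟙 m.val.hom, by intro X f; simp⟩
  comp {m m' m''} α β := ⟨α.val ≫ β.val, by
    intro X f
    have hα := α.property X f
    have hβ := β.property X f
    simp only [Bicategory.whiskerLeft_comp, Functor.map_comp, Category.assoc]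
    rw [hβ, ← Category.assoc, hα, Category.assoc]⟩
  id_comp := by intros; apply Subtype.ext; simp
  comp_id := by intros; apply Subtype.ext; simp
  assoc := by intros; apply Subtype.ext; simp

/-- The forgetful functor from a category of morphisms of pseudoalgebras and
transformations to the corresponding hom-category of `ℰ`. -/
@[simps]
def morForget {C C' : ℰ} (S : T.AlgData C) (S' : T.AlgData C') (P : LaxData S S' → Prop) :
    Mor S S' P ⥤ (C ⟶ C') where
  obj m := m.val.hom
  map α := α.val

/-- A pseudoalgebra is lax-idempotent when its unit 2-cells `atil` exhibit the unit of
an adjunction between extension and precomposition with the unit of the pseudomonad. -/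
def IsLaxIdempotent {C : ℰ} (S : T.AlgData C) : Prop :=
  ∀ X : 𝒜, ∃ adj : S.ext X ⊣ precompF C (T.unit X),
    ∀ f : J.obj X ⟶ C, adj.unit.app f = (S.atil f).hom

section Mates

variable {C C' : ℰ} {S : T.AlgData C} {S' : T.AlgData C'} {l : C ⟶ C'} {r : C' ⟶ C}

/-- The 2-cell `f ⇒ rℓf` obtained by whiskering the unit of an adjunction. -/
def nuW (adj : Bicategory.Adjunction l r) {a : ℰ} (f : a ⟶ C) : f ⟶ (f ≫ l) ≫ r :=
  (ρ_ f).inv ≫ f ◁ adj.unit ≫ (α_ f l r).inv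

/-- The 2-cell `ℓrg ⇒ g` obtained by whiskering the counit of an adjunction. -/
def epsW (adj : Bicategory.Adjunction l r) {a : ℰ} (g : a ⟶ C') : (g ≫ r) ≫ l ⟶ g :=
  (α_ g r l).hom ≫ g ◁ adj.counit ≫ (ρ_ g).hom

/-- The colax morphism structure on a left adjoint `ℓ` obtained as the mate of a lax
morphism structure on its right adjoint `r`. -/
def colaxMate (adj : Bicategory.Adjunction l r)
    (rl : ∀ (X : 𝒜) (g : J.obj X ⟶ C'), (S.ext X).obj (g ≫ r) ⟶ (S'.ext X).obj g ≫ r) :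
    ∀ (X : 𝒜) (f : J.obj X ⟶ C), (S.ext X).obj f ≫ l ⟶ (S'.ext X).obj (f ≫ l) :=
  fun X f =>
    (S.ext X).map (nuW adj f) ▷ l ≫ rl X (f ≫ l) ▷ l ≫
      (α_ ((S'.ext X).obj (f ≫ l)) r l).hom ≫ (S'.ext X).obj (f ≫ l) ◁ adj.counit ≫
      (ρ_ ((S'.ext X).obj (f ≫ l))).hom

/-- The lax morphism structure on a right adjoint `r` obtained as the mate of a colax
morphism structure on its left adjoint `ℓ`. -/
def laxMate (adj : Bicategory.Adjunction l r)
    (lc : ∀ (X : 𝒜) (f : J.obj X ⟶ C), (S.ext X).obj f ≫ l ⟶ (S'.ext X).obj (f ≫ l)) :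
    ∀ (X : 𝒜) (g : J.obj X ⟶ C'), (S.ext X).obj (g ≫ r) ⟶ (S'.ext X).obj g ≫ r :=
  fun X g =>
    (ρ_ ((S.ext X).obj (g ≫ r))).inv ≫ (S.ext X).obj (g ≫ r) ◁ adj.unit ≫
      (α_ ((S.ext X).obj (g ≫ r)) l r).inv ≫ lc X (g ≫ r) ▷ r ≫
      (S'.ext X).map (epsW adj g) ▷ r

end Mates

end RelativePseudomonad

end RelPsMnd

namespace RelativePseudomonad

variable {𝒜 : Type u₁} [Bicategory.{w₁, v₁} 𝒜] {ℰ : Type u₂} [Bicategory.{w₂, v₂} ℰ]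
  {J : Pseudofunctor 𝒜 ℰ} {T : RelativePseudomonad J}

theorem AlgData.Laws.ahat_natural_right {C : ℰ} {S : T.AlgData C} (hS : S.Laws) {X Y : 𝒜}
    (f : J.obj X ⟶ T.obj Y) {g g' : J.obj Y ⟶ C} (β : g ⟶ g') :
    (S.ahat f g).hom ≫ T.ext.obj f ◁ (S.ext Y).map β =
      (S.ext X).map (f ◁ (S.ext Y).map β) ≫ (S.ahat f g').hom := by
  simpa using (hS.ahat_natural (𝟙 f) β).symm

theorem isLaxMorphism_idLaxData {C : ℰ} {S : T.AlgData C} (hS : S.Laws) :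
    (idLaxData S).IsLaxMorphism where
  natural α := by
    dsimp only [idLaxData]
    simp only [← Functor.map_comp_assoc, Category.assoc,
      rightUnitor_naturality, ← rightUnitor_inv_naturality]
  unit f := by
    have h := hS.atil_natural (ρ_ f).hom
    dsimp only [idLaxData]
    simp only [Bicategory.whiskerLeft_comp, ← reassoc_of% h]
    simp
  assoc f g := by
    have h := hS.ahat_natural_right f (ρ_ g).hom
    dsimp only [idLaxData]
    simp only [Bicategory.whiskerLeft_comp, Category.assoc,
      Functor.map_comp, reassoc_of% h]
    simp only [← Functor.map_comp_assoc, rightUnitor_comp]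
    simp

theorem LaxData.IsLaxMorphism.comp {C C' C'' : ℰ} {S : T.AlgData C} {S' : T.AlgData C'}
    {S'' : T.AlgData C''} (hS'' : S''.Laws) {m : LaxData S S'} {m' : LaxData S' S''}
    (hm : m.IsLaxMorphism) (hm' : m'.IsLaxMorphism) : (compLaxData m m').IsLaxMorphism where
  natural {X f f'} α := by
    have h := hm.natural α
    have h' := hm'.natural (α ▷ m.hom)
    have e : α ▷ (m.hom ≫ m'.hom) ≫ (α_ f' m.hom m'.hom).inv =
      (α_ f m.hom m'.hom).inv ≫ α ▷ m.hom ▷ m'.hom := by simp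
    dsimp only [compLaxData]
    simp only [← Functor.map_comp_assoc, e]
    simp only [Functor.map_comp, Category.assoc, reassoc_of% h', ← comp_whiskerRight_assoc, h]
    simp
  unit {X} f := by
    have n := hS''.atil_natural (α_ f m.hom m'.hom).inv
    have h := congrArg (· ▷ m'.hom) (hm.unit f)
    have h' := hm'.unit (f ≫ m.hom)
    simp only [comp_whiskerRight] at h
    dsimp only [compLaxData]
    simp only [Bicategory.whiskerLeft_comp, ← reassoc_of% n,
      reassoc_of% h']
    rw [← associator_naturality_middle_assoc, reassoc_of% h]
    simp
  assoc {X Y} f g := by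
    have n := hS''.ahat_natural_right f (α_ g m.hom m'.hom).inv
    have h := congrArg (· ▷ m'.hom) (hm.assoc f g)
    have h' := hm'.assoc f (g ≫ m.hom)
    have k := hm'.natural (f ◁ m.lax Y g)
    have k' := hm'.natural (α_ f ((S.ext Y).obj g) m.hom).inv
    simp only [← Category.assoc] at h'
    rw [Iso.comp_inv_eq] at h'
    simp only [Category.assoc, comp_whiskerRight] at h h'
    dsimp only [compLaxData]
    simp only [Bicategory.whiskerLeft_comp, Category.assoc,
      Functor.map_comp, reassoc_of% n, reassoc_of% h']
    rw [← associator_naturality_middle_assoc]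
    have p : (α_ (T.ext.obj f) ((S.ext Y).obj g ≫ m.hom) m'.hom).hom ≫
        T.ext.obj f ◁ (α_ ((S.ext Y).obj g) m.hom m'.hom).hom ≫
          (α_ (T.ext.obj f) ((S.ext Y).obj g) (m.hom ≫ m'.hom)).inv =
        (α_ (T.ext.obj f) ((S.ext Y).obj g) m.hom).inv ▷ m'.hom ≫
          (α_ (T.ext.obj f ≫ (S.ext Y).obj g) m.hom m'.hom).hom := by simp
    have q : f ◁ m.lax Y g ▷ m'.hom ≫ f ◁ (α_ ((S.ext Y).obj g) m.hom m'.hom).hom ≫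
        (α_ f ((S.ext Y).obj g) (m.hom ≫ m'.hom)).inv ≫
          (α_ (f ≫ (S.ext Y).obj g) m.hom m'.hom).inv =
        (α_ f ((S'.ext Y).obj (g ≫ m.hom)) m'.hom).inv ≫ (f ◁ m.lax Y g) ▷ m'.hom ≫
          (α_ f ((S.ext Y).obj g) m.hom).inv ▷ m'.hom := by simp
    have q' := congrArg (S''.ext X).map q
    simp only [Functor.map_comp] at q'
    rw [p, reassoc_of% h, ← reassoc_of% k, ← reassoc_of% k', reassoc_of% q']
    simp

theorem IsTransformation.whiskerRight {C C' C'' : ℰ} {S : T.AlgData C} {S' : T.AlgData C'}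
    {S'' : T.AlgData C''} {m m₂ : LaxData S S'} {k : LaxData S' S''} (hk : k.IsLaxMorphism)
    {α : m.hom ⟶ m₂.hom} (hα : IsTransformation m m₂ α) :
    IsTransformation (compLaxData m k) (compLaxData m₂ k) (α ▷ k.hom) := by
  intro X f
  have h := congrArg (· ▷ k.hom) (hα X f)
  have h' := hk.natural (f ◁ α)
  have e : f ◁ α ▷ k.hom ≫ (α_ f m₂.hom k.hom).inv =
    (α_ f m.hom k.hom).inv ≫ (f ◁ α) ▷ k.hom := by simp
  simp only [comp_whiskerRight] at h
  dsimp only [compLaxData]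
  simp only [← Functor.map_comp_assoc, e]
  simp only [Functor.map_comp, Category.assoc, reassoc_of% h', reassoc_of% h]
  simp

theorem IsTransformation.whiskerLeft {C C' C'' : ℰ} {S : T.AlgData C} {S' : T.AlgData C'}
    {S'' : T.AlgData C''} (k : LaxData S S') {m m₂ : LaxData S' S''}
    {α : m.hom ⟶ m₂.hom} (hα : IsTransformation m m₂ α) :
    IsTransformation (compLaxData k m) (compLaxData k m₂) (k.hom ◁ α) := by
  intro X f
  have h := hα X (f ≫ k.hom)
  have e : f ◁ k.hom ◁ α ≫ (α_ f k.hom m₂.hom).inv =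
    (α_ f k.hom m.hom).inv ≫ (f ≫ k.hom) ◁ α := by simp
  dsimp only [compLaxData]
  simp only [← Functor.map_comp_assoc, e]
  simp only [Functor.map_comp, Category.assoc, reassoc_of% h, whisker_exchange_assoc]
  simp

theorem isTransformation_associator {C C' C'' C''' : ℰ} {S : T.AlgData C} {S' : T.AlgData C'}
    {S'' : T.AlgData C''} {S''' : T.AlgData C'''} (m : LaxData S S') (m' : LaxData S' S'')
    {m'' : LaxData S'' S'''} (hm'' : m''.IsLaxMorphism) :
    IsTransformation (compLaxData (compLaxData m m') m'')
      (compLaxData m (compLaxData m' m'')) (α_ m.hom m'.hom m''.hom).hom := by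
  intro X f
  have n := hm''.natural (α_ f m.hom m'.hom).inv
  have e : f ◁ (α_ m.hom m'.hom m''.hom).hom ≫ (α_ f m.hom (m'.hom ≫ m''.hom)).inv ≫
      (α_ (f ≫ m.hom) m'.hom m''.hom).inv =
    (α_ f (m.hom ≫ m'.hom) m''.hom).inv ≫ (α_ f m.hom m'.hom).inv ▷ m''.hom := by simp
  dsimp only [compLaxData]
  simp only [← Functor.map_comp_assoc, Category.assoc, e,
    comp_whiskerRight]
  simp only [Functor.map_comp, Category.assoc, reassoc_of% n]
  simp

theorem isTransformation_leftUnitor {C C' : ℰ} {S : T.AlgData C} {S' : T.AlgData C'}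
    {m : LaxData S S'} (hm : m.IsLaxMorphism) :
    IsTransformation (compLaxData (idLaxData S) m) m (λ_ m.hom).hom := by
  intro X f
  have n := hm.natural (ρ_ f).hom
  dsimp only [compLaxData, idLaxData]
  simp only [comp_whiskerRight,
    Category.assoc, ← reassoc_of% n, ← Functor.map_comp_assoc]
  simp

theorem isTransformation_rightUnitor {C C' : ℰ} {S : T.AlgData C} {S' : T.AlgData C'}
    (m : LaxData S S') :
    IsTransformation (compLaxData m (idLaxData S')) m (ρ_ m.hom).hom := by
  intro X f
  dsimp only [compLaxData, idLaxData]
  simp only [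
    Category.assoc, ← Functor.map_comp_assoc]
  simp

end RelativePseudomonad

open RelativePseudomonad in
/-- The `T`-pseudoalgebras, lax morphisms and transformations form a
bicategory `PsAlg_l(T)`: (1) the specified identity lax structure on `𝟙` is a lax
morphism; (2) the specified composite of two lax morphisms is a lax morphism; (3)–(4)
identity 2-cells and vertical composites (in `ℰ`) of transformations are transformations,
so that lax morphisms and transformations form hom-categories; (5)–(6) whiskering in `ℰ`
of a transformation with a lax morphism yields a transformation between the composites;
(7)–(9) the associators and unitors of `ℰ` are transformations between the corresponding
composite lax morphisms, providing the structural isomorphisms of `PsAlg_l(T)`. -/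
theorem psAlgL_bicategory
    {𝒜 : Type u₁} [Bicategory.{w₁, v₁} 𝒜] {ℰ : Type u₂} [Bicategory.{w₂, v₂} ℰ]
    {J : Pseudofunctor 𝒜 ℰ} (T : RelativePseudomonad J) :
    -- (1) the identity is a lax morphism
    (∀ {C : ℰ} (S : T.AlgData C), S.Laws → (idLaxData S).IsLaxMorphism) ∧
    -- (2) composition of lax morphisms
    (∀ {C C' C'' : ℰ} {S : T.AlgData C} {S' : T.AlgData C'} {S'' : T.AlgData C''},
      S.Laws → S'.Laws → S''.Laws →
      ∀ (m : LaxData S S') (m' : LaxData S' S''),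
        m.IsLaxMorphism → m'.IsLaxMorphism → (compLaxData m m').IsLaxMorphism) ∧
    -- (3) identity 2-cells are transformations
    (∀ {C C' : ℰ} {S : T.AlgData C} {S' : T.AlgData C'} (m : LaxData S S'),
      IsTransformation m m (𝟙 m.hom)) ∧
    -- (4) vertical composites of transformations are transformations
    (∀ {C C' : ℰ} {S : T.AlgData C} {S' : T.AlgData C'} (m m' m'' : LaxData S S')
      (α : m.hom ⟶ m'.hom) (β : m'.hom ⟶ m''.hom),
        IsTransformation m m' α → IsTransformation m' m'' β →
        IsTransformation m m'' (α ≫ β)) ∧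
    -- (5) right whiskering of a transformation with a lax morphism
    (∀ {C C' C'' : ℰ} {S : T.AlgData C} {S' : T.AlgData C'} {S'' : T.AlgData C''},
      S.Laws → S'.Laws → S''.Laws →
      ∀ (m m₂ : LaxData S S') (k : LaxData S' S''),
        m.IsLaxMorphism → m₂.IsLaxMorphism → k.IsLaxMorphism →
        ∀ α : m.hom ⟶ m₂.hom, IsTransformation m m₂ α →
          IsTransformation (compLaxData m k) (compLaxData m₂ k) (α ▷ k.hom)) ∧
    -- (6) left whiskering of a transformation with a lax morphism
    (∀ {C C' C'' : ℰ} {S : T.AlgData C} {S' : T.AlgData C'} {S'' : T.AlgData C''},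
      S.Laws → S'.Laws → S''.Laws →
      ∀ (k : LaxData S S') (m m₂ : LaxData S' S''),
        k.IsLaxMorphism → m.IsLaxMorphism → m₂.IsLaxMorphism →
        ∀ α : m.hom ⟶ m₂.hom, IsTransformation m m₂ α →
          IsTransformation (compLaxData k m) (compLaxData k m₂) (k.hom ◁ α)) ∧
    -- (7) the associators of ℰ are transformations
    (∀ {C C' C'' C''' : ℰ} {S : T.AlgData C} {S' : T.AlgData C'} {S'' : T.AlgData C''}
      {S''' : T.AlgData C'''},
      S.Laws → S'.Laws → S''.Laws → S'''.Laws →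
      ∀ (m : LaxData S S') (m' : LaxData S' S'') (m'' : LaxData S'' S'''),
        m.IsLaxMorphism → m'.IsLaxMorphism → m''.IsLaxMorphism →
        IsTransformation (compLaxData (compLaxData m m') m'')
          (compLaxData m (compLaxData m' m'')) (α_ m.hom m'.hom m''.hom).hom) ∧
    -- (8) the left unitors of ℰ are transformations
    (∀ {C C' : ℰ} {S : T.AlgData C} {S' : T.AlgData C'},
      S.Laws → S'.Laws →
      ∀ m : LaxData S S', m.IsLaxMorphism →
        IsTransformation (compLaxData (idLaxData S) m) m (λ_ m.hom).hom) ∧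
    -- (9) the right unitors of ℰ are transformations
    (∀ {C C' : ℰ} {S : T.AlgData C} {S' : T.AlgData C'},
      S.Laws → S'.Laws →
      ∀ m : LaxData S S', m.IsLaxMorphism →
        IsTransformation (compLaxData m (idLaxData S')) m (ρ_ m.hom).hom) := by
  refine ⟨fun S hS => isLaxMorphism_idLaxData hS,
    fun _ _ hS'' m m' hm hm' => hm.comp hS'' hm', fun m X f => by simp,
    fun m m' m'' α β hα hβ X f => ?_,
    fun _ _ _ m m₂ k _ _ hk α hα => hα.whiskerRight hk,
    fun _ _ _ k m m₂ _ _ _ α hα => hα.whiskerLeft k,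
    fun _ _ _ _ m m' m'' _ _ hm'' => isTransformation_associator m m' hm'',
    fun _ _ m hm => isTransformation_leftUnitor hm,
    fun _ _ m _ => isTransformation_rightUnitor m⟩
  rw [Bicategory.whiskerLeft_comp, Functor.map_comp, Category.assoc, hβ X f,
    reassoc_of% hα X f, Bicategory.whiskerLeft_comp]
end

section
/- Let J : 𝒜 → ℰ be a pseudofunctor and T a J-relative pseudomonad. The forgetful pseudofunctor U_T : PsAlg(T) → ℰ admits a left J-relative pseudoadjoint F_T sending each X in 𝒜 to the free T-pseudoalgebra F_T X, with unit 1-cells i_X : JX → U_T F_T X and with adjoint equivalences ℰ[JX, B] ⇄ PsAlg(T)[F_T X, (B, (-)^b, b̂, b̃)] whose left adjoint sends f : JX → B to the pseudomorphism (f^b, b̂_{f,−}), whose unit is given by the 2-cells b̃_f : f ⇒ f^b i_X, and whose counit at a pseudomorphism (h, h̄) is the composite (h i_X)^b ⇒ h (i_X)* ⇒ h 1_{TX} ≅ h built from h̄_{i_X} and h θ_X. Moreover, the J-relative pseudomonad induced by this relative pseudoadjunction is exactly T (same extension operators, units, and 2-cell data μ, η, θ). -/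
open CategoryTheory Bicategory

universe w₁ v₁ u₁ w₂ v₂ u₂

namespace RelativePseudomonad

variable {𝒜 : Type u₁} [Bicategory.{w₁, v₁} 𝒜] {ℰ : Type u₂} [Bicategory.{w₂, v₂} ℰ]
variable {J : Pseudofunctor 𝒜 ℰ} (T : RelativePseudomonad J)

/-- The lax morphism data from the free pseudoalgebra on `X` to a pseudoalgebra `S`
obtained by extension: the underlying 1-cell is `f^b` and the comparison 2-cells are
the `â`-components `b̂_{g,f}`. -/
@[simps]
def sharpData {C : ℰ} (S : T.AlgData C) {X : 𝒜} (f : J.obj X ⟶ C) :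
    LaxData (T.freeAlgData X) S where
  hom := (S.ext X).obj f
  lax _ g := (S.ahat g f).hom

/-- The counit of the free–forgetful relative pseudoadjunction at a lax morphism `m` from
a free pseudoalgebra: the composite `(h i_X)^b ⇒ h (i_X)^* ⇒ h 1_{TX} ≅ h`. -/
def counitData {C : ℰ} (S : T.AlgData C) {X : 𝒜} (m : LaxData (T.freeAlgData X) S) :
    (S.ext X).obj (T.unit X ≫ m.hom) ⟶ m.hom :=
  m.lax X (T.unit X) ≫ (T.theta X).hom ▷ m.hom ≫ (λ_ m.hom).hom

variable {T}

theorem AlgData.Laws.eq_id_of_map_eq_id {C : ℰ} {S : T.AlgData C} (hS : S.Laws) {X : 𝒜}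
    {f : J.obj X ⟶ C} {α : f ⟶ f} (h : (S.ext X).map α = 𝟙 _) : α = 𝟙 f := by
  have := hS.atil_natural α
  rw [h, whiskerLeft_id, Category.comp_id] at this
  rw [← cancel_mono (S.atil f).hom, this, Category.id_comp]

theorem AlgData.Laws.map_whiskerRight_ahat {C : ℰ} {S : T.AlgData C} (hS : S.Laws)
    {X Y : 𝒜} {f f' : J.obj X ⟶ T.obj Y} (α : f ⟶ f') (g : J.obj Y ⟶ C) :
    (S.ext X).map (α ▷ (S.ext Y).obj g) ≫ (S.ahat f' g).hom =
      (S.ahat f g).hom ≫ T.ext.map α ▷ (S.ext Y).obj g := by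
  simpa using hS.ahat_natural α (𝟙 g)

theorem map_whiskerRight_mul {X Y Z : 𝒜} {f f' : J.obj X ⟶ T.obj Y} (α : f ⟶ f')
    (g : J.obj Y ⟶ T.obj Z) :
    T.ext.map (α ▷ T.ext.obj g) ≫ (T.mul f' g).hom =
      (T.mul f g).hom ≫ T.ext.map α ▷ T.ext.obj g := by
  simpa using T.mul_natural α (𝟙 g)

theorem map_whiskerLeft_mul {X Y Z : 𝒜} (f : J.obj X ⟶ T.obj Y) {g g' : J.obj Y ⟶ T.obj Z}
    (β : g ⟶ g') :
    T.ext.map (f ◁ T.ext.map β) ≫ (T.mul f g').hom =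
      (T.mul f g).hom ≫ T.ext.obj f ◁ T.ext.map β := by
  simpa using T.mul_natural (𝟙 f) β

theorem map_eta_mul_theta {X Y : 𝒜} (f : J.obj X ⟶ T.obj Y) :
    T.ext.map (T.eta f).hom ≫ (T.mul (T.unit X) f).hom ≫ (T.theta X).hom ▷ T.ext.obj f ≫
      (λ_ (T.ext.obj f)).hom = 𝟙 _ := by
  have := T.unit_law f
  simp [← Category.assoc, ← Iso.eq_comp_inv] at this ⊢
  exact this

theorem AlgData.Laws.map_atil_ahat_theta {C : ℰ} {S : T.AlgData C} (hS : S.Laws) {X : 𝒜}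
    (f : J.obj X ⟶ C) :
    (S.ext X).map (S.atil f).hom ≫ (S.ahat (T.unit X) f).hom ≫
      (T.theta X).hom ▷ (S.ext X).obj f ≫ (λ_ ((S.ext X).obj f)).hom = 𝟙 _ := by
  have := hS.unit f
  simp [← Category.assoc, ← Iso.eq_comp_inv] at this ⊢
  exact this

/-- The unit 2-cells of a pseudoalgebra are compatible with its associativity 2-cells. -/
theorem AlgData.Laws.atil_ahat {C : ℰ} {S : T.AlgData C} (hS : S.Laws) {X Y : 𝒜}
    (g : J.obj X ⟶ T.obj Y) (h : J.obj Y ⟶ C) :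
    (S.atil (g ≫ (S.ext Y).obj h)).hom ≫ T.unit X ◁ (S.ahat g h).hom =
      (T.eta g).hom ▷ (S.ext Y).obj h ≫ (α_ (T.unit X) (T.ext.obj g) ((S.ext Y).obj h)).hom := by
  rw [← cancel_mono (α_ (T.unit X) (T.ext.obj g) ((S.ext Y).obj h)).inv,
    ← cancel_mono ((T.eta g).inv ▷ (S.ext Y).obj h)]
  simp only [Category.assoc, Iso.hom_inv_id_assoc, hom_inv_whiskerRight]
  apply hS.eq_id_of_map_eq_id
  rw [← cancel_mono (S.ahat g h).hom]
  simp only [Functor.map_comp, Category.assoc, Category.id_comp, hS.map_whiskerRight_ahat]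
  have key : T.ext.map (T.eta g).inv =
      (T.mul (T.unit X) g).hom ≫ (T.theta X).hom ▷ T.ext.obj g ≫ (λ_ (T.ext.obj g)).hom := by
    rw [← cancel_epi (T.ext.map (T.eta g).hom), map_eta_mul_theta, ← Functor.map_comp]
    simp
  have assoc := hS.assoc (T.unit X) g h =≫
    ((T.theta X).hom ▷ (T.ext.obj g ≫ (S.ext Y).obj h) ≫ (λ_ _).hom)
  have e : (T.mul (T.unit X) g).hom ▷ (S.ext Y).obj h ≫
      (α_ (T.ext.obj (T.unit X)) (T.ext.obj g) ((S.ext Y).obj h)).hom ≫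
      (T.theta X).hom ▷ (T.ext.obj g ≫ (S.ext Y).obj h) ≫ (λ_ _).hom =
      T.ext.map (T.eta g).inv ▷ (S.ext Y).obj h := by
    rw [key]; simp
  simp only [Category.assoc, e] at assoc
  rw [← assoc, whisker_exchange_assoc, id_whiskerLeft]
  have unit := hS.map_atil_ahat_theta (g ≫ (S.ext Y).obj h) =≫ (S.ahat g h).hom
  simpa using unit

theorem eq_id_of_whiskerRight_eq_id {a b : ℰ} {e : b ⟶ b} (i : e ≅ 𝟙 b) {p : a ⟶ b}
    {φ : p ⟶ p} (h : φ ▷ e = 𝟙 (p ≫ e)) : φ = 𝟙 p := by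
  rw [← whiskerRight_iff, ← cancel_epi (p ◁ i.hom), whisker_exchange, h]
  simp

/-- The counit 2-cells `θ` are compatible with the multiplication 2-cells. -/
theorem mul_whiskerLeft_theta {X Y : 𝒜} (f : J.obj X ⟶ T.obj Y) :
    (T.mul f (T.unit Y)).hom ≫ T.ext.obj f ◁ (T.theta Y).hom ≫ (ρ_ (T.ext.obj f)).hom =
      T.ext.map (f ◁ (T.theta Y).hom ≫ (ρ_ f).hom) := by
  have key : T.ext.map (T.eta (T.unit Y)).hom ≫ (T.mul (T.unit Y) (T.unit Y)).hom =
      (λ_ _).inv ≫ (T.theta Y).inv ▷ T.ext.obj (T.unit Y) := by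
    have := T.unit_law (T.unit Y)
    rw [← this]
    simp
  have assoc := T.ext.map (f ◁ T.ext.map (T.eta (T.unit Y)).hom) ≫=
    T.assoc f (T.unit Y) (T.unit Y)
  rw [← Category.assoc, map_whiskerLeft_mul, Category.assoc, ← whiskerLeft_comp, key] at assoc
  simp only [← Functor.map_comp_assoc, ← whiskerLeft_comp_assoc, key] at assoc
  have e : f ◁ ((λ_ _).inv ≫ (T.theta Y).inv ▷ T.ext.obj (T.unit Y)) ≫
      (α_ f (T.ext.obj (T.unit Y)) (T.ext.obj (T.unit Y))).inv =
      ((ρ_ f).inv ≫ f ◁ (T.theta Y).inv) ▷ T.ext.obj (T.unit Y) := by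
    simp
  rw [e, ← Category.assoc, map_whiskerRight_mul, Category.assoc, cancel_epi] at assoc
  rw [← cancel_epi (T.ext.map ((ρ_ f).inv ≫ f ◁ (T.theta Y).inv)), ← Functor.map_comp]
  have retract : ((ρ_ f).inv ≫ f ◁ (T.theta Y).inv) ≫ f ◁ (T.theta Y).hom ≫ (ρ_ f).hom = 𝟙 f := by
    simp
  rw [retract, CategoryTheory.Functor.map_id]
  apply eq_id_of_whiskerRight_eq_id (T.theta Y)
  have := assoc.symm =≫ T.ext.obj f ◁ ((T.theta Y).hom ▷ T.ext.obj (T.unit Y) ≫ (λ_ _).hom)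
  simpa using this

/-- The unit 2-cell at the unit 1-cell is inverse to `θ` whiskered with the unit 1-cell. -/
theorem eta_unit_whiskerLeft_theta (X : 𝒜) :
    (T.eta (T.unit X)).hom ≫ T.unit X ◁ (T.theta X).hom ≫ (ρ_ (T.unit X)).hom = 𝟙 _ := by
  apply (T.freeAlgData_laws X).eq_id_of_map_eq_id
  have swap : T.ext.obj (T.unit X) ◁ (T.theta X).hom ≫ (ρ_ _).hom =
      (T.theta X).hom ▷ T.ext.obj (T.unit X) ≫ (λ_ _).hom := by
    rw [← cancel_mono (T.theta X).hom, Category.assoc, Category.assoc,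
      ← rightUnitor_naturality, ← leftUnitor_naturality, unitors_equal,
      whisker_exchange_assoc]
  change T.ext.map _ = _
  rw [Functor.map_comp, ← mul_whiskerLeft_theta, swap, map_eta_mul_theta]
  rfl

theorem AlgData.Laws.sharpData_isPseudoMorphism {C : ℰ} {S : T.AlgData C} (hS : S.Laws)
    {X : 𝒜} (f : J.obj X ⟶ C) : (T.sharpData S f).IsPseudoMorphism where
  left :=
    { natural α := hS.map_whiskerRight_ahat α f
      unit g := hS.atil_ahat g f
      assoc g h := by
        have := hS.assoc g h f =≫ (α_ _ _ _).inv
        simp only [Category.assoc, Iso.hom_inv_id, Category.comp_id] at this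
        exact this }
  right Y g := Iso.isIso_hom (S.ahat g f)

theorem AlgData.Laws.isTransformation_map {C : ℰ} {S : T.AlgData C} (hS : S.Laws) {X : 𝒜}
    {f f' : J.obj X ⟶ C} (α : f ⟶ f') :
    IsTransformation (T.sharpData S f) (T.sharpData S f') ((S.ext X).map α) := by
  intro Y g
  have := hS.ahat_natural (𝟙 g) α
  rw [id_whiskerRight, Category.id_comp, CategoryTheory.Functor.map_id, id_whiskerRight,
    Category.id_comp] at this
  exact this

/-- The comparison 2-cells of a lax morphism out of a free pseudoalgebra, with the extension
operator of the free pseudoalgebra unfolded. -/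
def LaxData.freeLax {C : ℰ} {S : T.AlgData C} {X : 𝒜} (m : LaxData (T.freeAlgData X) S)
    {Y : 𝒜} (g : J.obj Y ⟶ T.obj X) : (S.ext Y).obj (g ≫ m.hom) ⟶ T.ext.obj g ≫ m.hom :=
  m.lax Y g

theorem LaxData.IsLaxMorphism.isTransformation_counitData {C : ℰ} {S : T.AlgData C} {X : 𝒜}
    {m : LaxData (T.freeAlgData X) S} (hm : m.IsLaxMorphism) :
    IsTransformation (T.sharpData S (T.unit X ≫ m.hom)) m (T.counitData S m) := by
  intro Y g
  have assoc : (S.ahat g (T.unit X ≫ m.hom)).hom ≫ T.ext.obj g ◁ m.freeLax (T.unit X) ≫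
        (α_ (T.ext.obj g) (T.ext.obj (T.unit X)) m.hom).inv =
      (S.ext Y).map (g ◁ m.freeLax (T.unit X)) ≫
        (S.ext Y).map (α_ g (T.ext.obj (T.unit X)) m.hom).inv ≫
        m.freeLax (g ≫ T.ext.obj (T.unit X)) ≫ (T.mul g (T.unit X)).hom ▷ m.hom :=
    hm.assoc g (T.unit X)
  have nat : (S.ext Y).map ((g ◁ (T.theta X).hom ≫ (ρ_ g).hom) ▷ m.hom) ≫ m.freeLax g =
      m.freeLax (g ≫ T.ext.obj (T.unit X)) ≫
        T.ext.map (g ◁ (T.theta X).hom ≫ (ρ_ g).hom) ▷ m.hom :=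
    hm.natural (g ◁ (T.theta X).hom ≫ (ρ_ g).hom)
  have split {a : ℰ} (k : a ⟶ T.obj X) :
      k ◁ (m.freeLax (T.unit X) ≫ (T.theta X).hom ▷ m.hom ≫ (λ_ m.hom).hom) =
        k ◁ m.freeLax (T.unit X) ≫ (α_ k (T.ext.obj (T.unit X)) m.hom).inv ≫
          (k ◁ (T.theta X).hom ≫ (ρ_ k).hom) ▷ m.hom := by
    simp
  change (S.ext Y).map (g ◁ (m.freeLax (T.unit X) ≫ (T.theta X).hom ▷ m.hom ≫ (λ_ m.hom).hom)) ≫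
      m.freeLax g = (S.ahat g (T.unit X ≫ m.hom)).hom ≫
        T.ext.obj g ◁ (m.freeLax (T.unit X) ≫ (T.theta X).hom ▷ m.hom ≫ (λ_ m.hom).hom)
  rw [split, split, Functor.map_comp, Functor.map_comp, Category.assoc, Category.assoc, nat,
    ← mul_whiskerLeft_theta, comp_whiskerRight]
  have := assoc =≫ (T.ext.obj g ◁ (T.theta X).hom ≫ (ρ_ (T.ext.obj g)).hom) ▷ m.hom
  simp only [Category.assoc] at this
  exact this.symm

theorem counitData_naturality {C : ℰ} {S : T.AlgData C} {X : 𝒜}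
    {m m' : LaxData (T.freeAlgData X) S} {α : m.hom ⟶ m'.hom} (hα : IsTransformation m m' α) :
    (S.ext X).map (T.unit X ◁ α) ≫ T.counitData S m' = T.counitData S m ≫ α := by
  have key : (S.ext X).map (T.unit X ◁ α) ≫ m'.freeLax (T.unit X) =
      m.freeLax (T.unit X) ≫ T.ext.obj (T.unit X) ◁ α := hα X (T.unit X)
  change (S.ext X).map (T.unit X ◁ α) ≫ m'.freeLax (T.unit X) ≫ (T.theta X).hom ▷ m'.hom ≫
      (λ_ m'.hom).hom =
    (m.freeLax (T.unit X) ≫ (T.theta X).hom ▷ m.hom ≫ (λ_ m.hom).hom) ≫ α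
  rw [← Category.assoc, key, Category.assoc, whisker_exchange_assoc]
  simp

theorem LaxData.IsPseudoMorphism.isIso_counitData {C : ℰ} {S : T.AlgData C} {X : 𝒜}
    {m : LaxData (T.freeAlgData X) S} (hm : m.IsPseudoMorphism) :
    IsIso (T.counitData S m) := by
  have : IsIso (m.freeLax (T.unit X)) := hm.2 X (T.unit X)
  exact (asIso (m.freeLax (T.unit X)) ≪≫ whiskerRightIso (T.theta X) m.hom ≪≫ λ_ m.hom).isIso_hom

theorem LaxData.IsLaxMorphism.atil_counitData {C : ℰ} {S : T.AlgData C} {X : 𝒜}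
    {m : LaxData (T.freeAlgData X) S} (hm : m.IsLaxMorphism) :
    (S.atil (T.unit X ≫ m.hom)).hom ≫ T.unit X ◁ T.counitData S m =
      𝟙 (T.unit X ≫ m.hom) := by
  have unit : (S.atil (T.unit X ≫ m.hom)).hom ≫ T.unit X ◁ m.freeLax (T.unit X) =
      (T.eta (T.unit X)).hom ▷ m.hom ≫ (α_ (T.unit X) (T.ext.obj (T.unit X)) m.hom).hom :=
    hm.unit (T.unit X)
  have tri := congrArg (· ▷ m.hom) (T.eta_unit_whiskerLeft_theta X)
  change (S.atil (T.unit X ≫ m.hom)).hom ≫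
    T.unit X ◁ (m.freeLax (T.unit X) ≫ (T.theta X).hom ▷ m.hom ≫ (λ_ m.hom).hom) = _
  rw [whiskerLeft_comp, ← Category.assoc, unit, Category.assoc]
  simpa using tri

variable (T)

theorem map_rightUnitor_inv_counitData_idLaxData (X : 𝒜) :
    T.ext.map (ρ_ (T.unit X)).inv ≫
      T.counitData (T.freeAlgData X) (idLaxData (T.freeAlgData X)) = (T.theta X).hom := by
  change T.ext.map (ρ_ (T.unit X)).inv ≫
    (T.ext.map (ρ_ (T.unit X)).hom ≫ (ρ_ (T.ext.obj (T.unit X))).inv) ≫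
      (T.theta X).hom ▷ 𝟙 (T.obj X) ≫ (λ_ (𝟙 (T.obj X))).hom = _
  rw [Category.assoc, ← Functor.map_comp_assoc]
  simp [unitors_equal]

theorem map_eta_counitData_compLaxData {X Y Z : 𝒜} (f : J.obj X ⟶ T.obj Y)
    (g : J.obj Y ⟶ T.obj Z) :
    T.ext.map ((T.eta f).hom ▷ T.ext.obj g ≫ (α_ (T.unit X) (T.ext.obj f) (T.ext.obj g)).hom) ≫
      T.counitData (T.freeAlgData Z) (compLaxData (T.sharpData (T.freeAlgData Y) f)
        (T.sharpData (T.freeAlgData Z) g)) = (T.mul f g).hom := by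
  have tri := congrArg (· ▷ T.ext.obj g) (T.map_eta_mul_theta f)
  change T.ext.map
      ((T.eta f).hom ▷ T.ext.obj g ≫ (α_ (T.unit X) (T.ext.obj f) (T.ext.obj g)).hom) ≫
    (T.ext.map (α_ (T.unit X) (T.ext.obj f) (T.ext.obj g)).inv ≫
      (T.mul (T.unit X ≫ T.ext.obj f) g).hom ≫ (T.mul (T.unit X) f).hom ▷ T.ext.obj g ≫
      (α_ (T.ext.obj (T.unit X)) (T.ext.obj f) (T.ext.obj g)).hom) ≫
      (T.theta X).hom ▷ (T.ext.obj f ≫ T.ext.obj g) ≫ (λ_ (T.ext.obj f ≫ T.ext.obj g)).hom = _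
  rw [Category.assoc, ← Functor.map_comp_assoc, Category.assoc, Iso.hom_inv_id,
    Category.comp_id, Category.assoc, ← Category.assoc, map_whiskerRight_mul, Category.assoc]
  simp at tri ⊢
  simp [tri]

/-- The forgetful pseudofunctor `U_T : PsAlg(T) → ℰ` admits a left
`J`-relative pseudoadjoint `F_T` given by the free pseudoalgebras, with unit `i_X`,
with adjoint equivalences whose left adjoints send `f : JX ⟶ B` to the pseudomorphism
`(f^b, b̂_{f,−})`, whose unit is `b̃` and whose counit at a pseudomorphism `(h, h̄)` is
`(h i_X)^b ⇒ h (i_X)^* ⇒ h 1_{TX} ≅ h`; moreover the relative pseudomonad induced by this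
relative pseudoadjunction is exactly `T` (same extensions, unit, and `η`, `θ`, `μ`). -/
theorem free_forgetful_relative_pseudoadjunction :
    -- the extension of `f` is a pseudomorphism from the free pseudoalgebra, functorially
    (∀ {C : ℰ} (S : T.AlgData C), S.Laws →
      ∀ {X : 𝒜} (f : J.obj X ⟶ C), (T.sharpData S f).IsPseudoMorphism) ∧
    (∀ {C : ℰ} (S : T.AlgData C), S.Laws →
      ∀ {X : 𝒜} {f f' : J.obj X ⟶ C} (α : f ⟶ f'),
        IsTransformation (T.sharpData S f) (T.sharpData S f') ((S.ext X).map α)) ∧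
    -- the counit is a transformation, natural in `m`, and invertible at pseudomorphisms
    (∀ {C : ℰ} (S : T.AlgData C), S.Laws →
      ∀ {X : 𝒜} (m : LaxData (T.freeAlgData X) S), m.IsLaxMorphism →
        IsTransformation (T.sharpData S (T.unit X ≫ m.hom)) m (T.counitData S m)) ∧
    (∀ {C : ℰ} (S : T.AlgData C), S.Laws →
      ∀ {X : 𝒜} (m m' : LaxData (T.freeAlgData X) S), m.IsLaxMorphism →
        m'.IsLaxMorphism → ∀ α : m.hom ⟶ m'.hom, IsTransformation m m' α →
          (S.ext X).map (T.unit X ◁ α) ≫ T.counitData S m' = T.counitData S m ≫ α) ∧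
    (∀ {C : ℰ} (S : T.AlgData C), S.Laws →
      ∀ {X : 𝒜} (m : LaxData (T.freeAlgData X) S), m.IsPseudoMorphism →
        IsIso (T.counitData S m)) ∧
    -- the triangle laws for the unit `b̃` and the counit
    (∀ {C : ℰ} (S : T.AlgData C), S.Laws →
      ∀ {X : 𝒜} (f : J.obj X ⟶ C),
        (S.ext X).map (S.atil f).hom ≫ T.counitData S (T.sharpData S f) =
          𝟙 ((S.ext X).obj f)) ∧
    (∀ {C : ℰ} (S : T.AlgData C), S.Laws →
      ∀ {X : 𝒜} (m : LaxData (T.freeAlgData X) S), m.IsLaxMorphism →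
        (S.atil (T.unit X ≫ m.hom)).hom ≫ T.unit X ◁ T.counitData S m =
          𝟙 (T.unit X ≫ m.hom)) ∧
    -- the induced relative pseudomonad is exactly `T`:
    -- the induced extension operator and unit 2-cells coincide with those of `T`
    (∀ {X Y : 𝒜} (f : J.obj X ⟶ T.obj Y),
      (T.sharpData (T.freeAlgData Y) f).hom = T.ext.obj f) ∧
    (∀ {X Y : 𝒜} (f : J.obj X ⟶ T.obj Y), (T.freeAlgData Y).atil f = T.eta f) ∧
    -- the induced `θ` coincides with `θ`
    (∀ X : 𝒜,
      T.ext.map (ρ_ (T.unit X)).inv ≫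
          T.counitData (T.freeAlgData X) (idLaxData (T.freeAlgData X)) =
        (T.theta X).hom) ∧
    -- the induced `μ` coincides with `μ`
    (∀ {X Y Z : 𝒜} (f : J.obj X ⟶ T.obj Y) (g : J.obj Y ⟶ T.obj Z),
      T.ext.map ((T.eta f).hom ▷ T.ext.obj g ≫
            (α_ (T.unit X) (T.ext.obj f) (T.ext.obj g)).hom) ≫
          T.counitData (T.freeAlgData Z)
            (compLaxData (T.sharpData (T.freeAlgData Y) f)
              (T.sharpData (T.freeAlgData Z) g)) =
        (T.mul f g).hom) := by
  exact ⟨fun _ hS _ f => hS.sharpData_isPseudoMorphism f,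
    fun _ hS _ _ _ α => hS.isTransformation_map α,
    fun _ _ _ _ hm => hm.isTransformation_counitData,
    fun _ _ _ _ _ _ _ _ hα => counitData_naturality hα,
    fun _ _ _ _ hm => hm.isIso_counitData,
    fun _ hS _ f => hS.map_atil_ahat_theta f,
    fun _ _ _ _ hm => hm.atil_counitData,
    fun _ => rfl,
    fun _ => rfl,
    T.map_rightUnitor_inv_counitData_idLaxData,
    T.map_eta_counitData_compLaxData⟩

end RelativePseudomonad
end

section
/- Let J : 𝒜 → ℰ be a pseudofunctor, T a J-relative pseudomonad, (A, (-)^a, â, ã) and (B, (-)^b, b̂, b̃) T-pseudoalgebras, and (ν, ε) : ℓ ⊣ r an adjunction in ℰ with ℓ : A → B and r : B → A. Then colax morphism structures on ℓ and lax morphism structures on r are in bijection via taking mates: a lax structure r̄ on r corresponds to the colax structure ℓ̄ on ℓ with components ℓ̄_f := (ε (ℓf)^b) ∘ (ℓ r̄_{ℓf}) ∘ (ℓ (ν f)^a) : ℓ f^a ⇒ (ℓ f)^b for f : JX → A, and a colax structure ℓ̄ on ℓ corresponds to the lax structure r̄ on r with components r̄_g := (r (ε g)^b) ∘ (r ℓ̄_{rg})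 ∘ (ν (rg)^a) : (r g)^a ⇒ r g^b for g : JX → B; these assignments are mutually inverse. -/
open CategoryTheory Bicategory

universe w₁ v₁ u₁ w₂ v₂ u₂

namespace RelativePseudomonad

section MateCalculus

variable {𝒜 : Type u₁} [Bicategory.{w₁, v₁} 𝒜] {ℰ : Type u₂} [Bicategory.{w₂, v₂} ℰ]
  {C C' : ℰ} {l : C ⟶ C'} {r : C' ⟶ C} (adj : Bicategory.Adjunction l r)

theorem nuW_natural {a : ℰ} {f f' : a ⟶ C} (α : f ⟶ f') :
    α ≫ nuW adj f' = nuW adj f ≫ α ▷ l ▷ r := by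
  simp only [nuW, Category.assoc, rightUnitor_inv_naturality_assoc, ← whisker_exchange_assoc,
    associator_inv_naturality_left]

theorem epsW_natural {a : ℰ} {g g' : a ⟶ C'} (β : g ⟶ g') :
    β ▷ r ▷ l ≫ epsW adj g' = epsW adj g ≫ β := by
  simp only [epsW, Category.assoc, associator_naturality_left_assoc, ← whisker_exchange_assoc,
    rightUnitor_naturality]

theorem whiskerLeft_nuW {a b : ℰ} (h : a ⟶ b) (f : b ⟶ C) :
    h ◁ nuW adj f =
      nuW adj (h ≫ f) ≫ (α_ h f l).hom ▷ r ≫ (α_ h (f ≫ l) r).hom := by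
  simp [nuW]

theorem epsW_comp {a b : ℰ} (h : a ⟶ b) (g : b ⟶ C') :
    epsW adj (h ≫ g) = (α_ h g r).hom ▷ l ≫ (α_ h (g ≫ r) l).hom ≫ h ◁ epsW adj g := by
  simp [epsW]

theorem nuW_whiskerRight_epsW {a : ℰ} (f : a ⟶ C) :
    nuW adj f ▷ l ≫ epsW adj (f ≫ l) = 𝟙 (f ≫ l) := by
  calc _ = 𝟙 _ ⊗≫ f ◁ leftZigzag adj.unit adj.counit ⊗≫ 𝟙 _ := by
        dsimp only [nuW, epsW, leftZigzag]
        bicategory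
    _ = _ := by
        rw [adj.left_triangle]
        bicategory

theorem nuW_epsW_whiskerRight {a : ℰ} (g : a ⟶ C') :
    nuW adj (g ≫ r) ≫ epsW adj g ▷ r = 𝟙 (g ≫ r) := by
  calc _ = 𝟙 _ ⊗≫ g ◁ rightZigzag adj.unit adj.counit ⊗≫ 𝟙 _ := by
        dsimp only [nuW, epsW, rightZigzag]
        bicategory
    _ = _ := by
        rw [adj.right_triangle]
        bicategory

variable {J : Pseudofunctor 𝒜 ℰ} {T : RelativePseudomonad J}
  {S : T.AlgData C} {S' : T.AlgData C'}

theorem laxMate_eq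
    (lc : ∀ (X : 𝒜) (f : J.obj X ⟶ C), (S.ext X).obj f ≫ l ⟶ (S'.ext X).obj (f ≫ l))
    (X : 𝒜) (g : J.obj X ⟶ C') :
    laxMate adj lc X g =
      nuW adj ((S.ext X).obj (g ≫ r)) ≫ (lc X (g ≫ r) ≫ (S'.ext X).map (epsW adj g)) ▷ r := by
  simp [laxMate, nuW]

section Lax

variable (rl : ∀ (X : 𝒜) (g : J.obj X ⟶ C'), (S.ext X).obj (g ≫ r) ⟶ (S'.ext X).obj g ≫ r)

theorem colaxMate_eq (X : 𝒜) (f : J.obj X ⟶ C) :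
    colaxMate adj rl X f =
      ((S.ext X).map (nuW adj f) ≫ rl X (f ≫ l)) ▷ l ≫ epsW adj ((S'.ext X).obj (f ≫ l)) := by
  simp [colaxMate, epsW]

theorem nuW_colaxMate (X : 𝒜) (f : J.obj X ⟶ C) :
    nuW adj ((S.ext X).obj f) ≫ colaxMate adj rl X f ▷ r =
      (S.ext X).map (nuW adj f) ≫ rl X (f ≫ l) := by
  rw [colaxMate_eq, comp_whiskerRight, ← Category.assoc, ← nuW_natural, Category.assoc,
    nuW_epsW_whiskerRight, Category.comp_id]

theorem laxMate_colaxMate (h : (⟨r, rl⟩ : LaxData S' S).IsLaxMorphism) :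
    laxMate adj (colaxMate adj rl) = rl := by
  funext X g
  have hn := h.natural (epsW adj g)
  dsimp only at hn
  rw [laxMate_eq, comp_whiskerRight, reassoc_of% nuW_colaxMate adj rl X (g ≫ r), ← hn,
    ← Functor.map_comp_assoc, nuW_epsW_whiskerRight, CategoryTheory.Functor.map_id,
    Category.id_comp]

end Lax

section Colax

variable (lc : ∀ (X : 𝒜) (f : J.obj X ⟶ C), (S.ext X).obj f ≫ l ⟶ (S'.ext X).obj (f ≫ l))

theorem laxMate_epsW (X : 𝒜) (g : J.obj X ⟶ C') :
    laxMate adj lc X g ▷ l ≫ epsW adj ((S'.ext X).obj g) =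
      lc X (g ≫ r) ≫ (S'.ext X).map (epsW adj g) := by
  rw [laxMate_eq, comp_whiskerRight, Category.assoc, epsW_natural, ← Category.assoc,
    nuW_whiskerRight_epsW, Category.id_comp]

theorem colaxMate_laxMate (h : (⟨l, lc⟩ : ColaxData S S').IsColaxMorphism) :
    colaxMate adj (laxMate adj lc) = lc := by
  funext X f
  have hn := h.natural (nuW adj f)
  dsimp only at hn
  rw [colaxMate_eq, comp_whiskerRight, Category.assoc, laxMate_epsW, ← reassoc_of% hn,
    ← Functor.map_comp, nuW_whiskerRight_epsW, CategoryTheory.Functor.map_id, Category.comp_id]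

end Colax

theorem LaxData.IsLaxMorphism.colaxMate (hS : S.Laws)
    {rl : ∀ (X : 𝒜) (g : J.obj X ⟶ C'), (S.ext X).obj (g ≫ r) ⟶ (S'.ext X).obj g ≫ r}
    (h : (⟨r, rl⟩ : LaxData S' S).IsLaxMorphism) :
    (⟨l, RelativePseudomonad.colaxMate adj rl⟩ : ColaxData S S').IsColaxMorphism where
  natural {X f f'} α := by
    have hn := h.natural (α ▷ l)
    dsimp only at hn ⊢
    rw [colaxMate_eq, colaxMate_eq, Category.assoc, ← epsW_natural, ← comp_whiskerRight_assoc,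
      ← comp_whiskerRight_assoc, Category.assoc, ← hn, ← Functor.map_comp_assoc,
      ← Functor.map_comp_assoc, nuW_natural]
  unit {X} f := by
    have hu := h.unit (f ≫ l)
    dsimp only at hu ⊢
    calc _ = ((S.atil f).hom ≫ T.unit X ◁ (S.ext X).map (nuW adj f) ≫
              T.unit X ◁ rl X (f ≫ l)) ▷ l ≫ (α_ _ _ _).hom ≫ T.unit X ◁ epsW adj _ := by
            rw [colaxMate_eq]; simp
      _ = (nuW adj f ≫ (S'.atil (f ≫ l)).hom ▷ r) ▷ l ≫
            epsW adj (T.unit X ≫ (S'.ext X).obj (f ≫ l)) := by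
            rw [← reassoc_of% hS.atil_natural (nuW adj f), hu, epsW_comp]; simp
      _ = _ := by
            rw [comp_whiskerRight, Category.assoc, epsW_natural, ← Category.assoc,
              nuW_whiskerRight_epsW, Category.id_comp]
  assoc {X Y} f g := by
    have ha := h.assoc f (g ≫ l)
    have hm := hS.ahat_natural (𝟙 f) (nuW adj g)
    have hn := h.natural ((α_ f ((S.ext Y).obj g) l).hom ≫
      f ◁ RelativePseudomonad.colaxMate adj rl Y g)
    dsimp only at ha hn ⊢
    simp only [id_whiskerRight, Category.id_comp, CategoryTheory.Functor.map_id] at hm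
    have hθ : nuW adj (f ≫ (S.ext Y).obj g) ≫ ((α_ f ((S.ext Y).obj g) l).hom ≫
          f ◁ RelativePseudomonad.colaxMate adj rl Y g) ▷ r =
        f ◁ (S.ext Y).map (nuW adj g) ≫ f ◁ rl Y (g ≫ l) ≫ (α_ _ _ _).inv := by
      rw [← whiskerLeft_comp_assoc, ← nuW_colaxMate, whiskerLeft_comp, whiskerLeft_nuW]
      simp
    calc _ = ((S.ahat f g).hom ≫ T.ext.obj f ◁ (S.ext Y).map (nuW adj g) ≫
              T.ext.obj f ◁ rl Y (g ≫ l) ≫ (α_ _ _ _).inv) ▷ l ≫ epsW adj _ := by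
            rw [colaxMate_eq, epsW_comp]; simp
      _ = ((S.ext X).map (f ◁ (S.ext Y).map (nuW adj g) ≫ f ◁ rl Y (g ≫ l) ≫
            (α_ _ _ _).inv) ≫ rl X (f ≫ (S'.ext Y).obj (g ≫ l))) ▷ l ≫
            epsW adj _ ≫ (S'.ahat f (g ≫ l)).hom := by
            rw [← reassoc_of% hm, ha, ← epsW_natural]; simp
      _ = _ := by
            rw [← hθ, Functor.map_comp, Category.assoc, hn, colaxMate_eq adj rl X]
            simp only [comp_whiskerRight, Category.assoc, reassoc_of% epsW_natural, Functor.map_comp]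

theorem ColaxData.IsColaxMorphism.laxMate (hS' : S'.Laws)
    {lc : ∀ (X : 𝒜) (f : J.obj X ⟶ C), (S.ext X).obj f ≫ l ⟶ (S'.ext X).obj (f ≫ l)}
    (h : (⟨l, lc⟩ : ColaxData S S').IsColaxMorphism) :
    (⟨r, RelativePseudomonad.laxMate adj lc⟩ : LaxData S' S).IsLaxMorphism where
  natural {X g g'} β := by
    have hn := h.natural (β ▷ r)
    dsimp only at hn ⊢
    rw [laxMate_eq, laxMate_eq, ← Category.assoc, nuW_natural, Category.assoc, Category.assoc,
      ← comp_whiskerRight, ← comp_whiskerRight, ← reassoc_of% hn, Category.assoc,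
      ← Functor.map_comp, ← Functor.map_comp, epsW_natural]
  unit {X} g := by
    have hu := h.unit (g ≫ r)
    dsimp only at hu ⊢
    calc _ = nuW adj (g ≫ r) ≫ ((S.atil (g ≫ r)).hom ▷ l ≫ (α_ _ _ _).hom ≫
              T.unit X ◁ lc X (g ≫ r) ≫ T.unit X ◁ (S'.ext X).map (epsW adj g)) ▷ r ≫
              (α_ _ _ _).hom := by
            rw [laxMate_eq, whiskerLeft_comp, whiskerLeft_nuW, comp_whiskerRight]
            simp only [Category.assoc]
            rw [reassoc_of% nuW_natural adj (S.atil (g ≫ r)).hom]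
            simp
      _ = _ := by
            rw [reassoc_of% hu, ← hS'.atil_natural, comp_whiskerRight_assoc,
              reassoc_of% nuW_epsW_whiskerRight adj g]
  assoc {X Y} f g := by
    have ha := h.assoc f (g ≫ r)
    have hm := hS'.ahat_natural (𝟙 f) (epsW adj g)
    have hn := h.natural (f ◁ RelativePseudomonad.laxMate adj lc Y g ≫
      (α_ f ((S'.ext Y).obj g) r).inv)
    dsimp only at ha hn ⊢
    simp only [id_whiskerRight, Category.id_comp, CategoryTheory.Functor.map_id] at hm
    have hθ : (f ◁ RelativePseudomonad.laxMate adj lc Y g ≫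
          (α_ f ((S'.ext Y).obj g) r).inv) ▷ l ≫ epsW adj (f ≫ (S'.ext Y).obj g) =
        (α_ _ _ _).hom ≫ f ◁ lc Y (g ≫ r) ≫ f ◁ (S'.ext Y).map (epsW adj g) := by
      rw [← whiskerLeft_comp, ← laxMate_epsW, whiskerLeft_comp, epsW_comp]
      simp
    calc _ = nuW adj _ ≫ ((S.ahat f (g ≫ r)).hom ▷ l ≫ (α_ _ _ _).hom ≫
              T.ext.obj f ◁ lc Y (g ≫ r) ≫
              T.ext.obj f ◁ (S'.ext Y).map (epsW adj g)) ▷ r := by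
            rw [laxMate_eq, whiskerLeft_comp, whiskerLeft_nuW, comp_whiskerRight]
            simp only [Category.assoc]
            rw [reassoc_of% nuW_natural adj (S.ahat f (g ≫ r)).hom]
            simp
      _ = nuW adj _ ≫ (lc X (f ≫ (S.ext Y).obj (g ≫ r)) ≫
            (S'.ext X).map ((α_ _ _ _).hom ≫ f ◁ lc Y (g ≫ r) ≫
              f ◁ (S'.ext Y).map (epsW adj g)) ≫ (S'.ahat f g).hom) ▷ r := by
            rw [reassoc_of% ha, ← hm]; simp
      _ = _ := by
            rw [← hθ, Functor.map_comp, Category.assoc, reassoc_of% hn, laxMate_eq adj lc X,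
              ← Functor.map_comp_assoc, Category.assoc, reassoc_of% nuW_natural]
            simp only [comp_whiskerRight, Category.assoc]

end MateCalculus

end RelativePseudomonad

open RelativePseudomonad in
/-- doctrinal adjunction.  Given an adjunction `(ν, ε) : ℓ ⊣ r` in `ℰ`
between the carriers of two `T`-pseudoalgebras, taking mates gives a bijection between
colax morphism structures on `ℓ` and lax morphism structures on `r`: the mate of a lax
structure `r̄` is the colax structure with components
`(ε (ℓf)^b) ∘ (ℓ r̄_{ℓf}) ∘ (ℓ (ν f)^a)`, the mate of a colax structure `ℓ̄` is the lax
structure with components `(r (ε g)^b) ∘ (r ℓ̄_{rg}) ∘ (ν (rg)^a)`, and these assignments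
are mutually inverse. -/
theorem doctrinal_adjunction
    {𝒜 : Type u₁} [Bicategory.{w₁, v₁} 𝒜] {ℰ : Type u₂} [Bicategory.{w₂, v₂} ℰ]
    {J : Pseudofunctor 𝒜 ℰ} (T : RelativePseudomonad J)
    {CA CB : ℰ} (SA : T.AlgData CA) (SB : T.AlgData CB)
    (hA : SA.Laws) (hB : SB.Laws)
    (ℓ : CA ⟶ CB) (r : CB ⟶ CA) (adj : Bicategory.Adjunction ℓ r) :
    (∀ rl : ∀ (X : 𝒜) (g : J.obj X ⟶ CB),
        (SA.ext X).obj (g ≫ r) ⟶ (SB.ext X).obj g ≫ r,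
      (⟨r, rl⟩ : LaxData SB SA).IsLaxMorphism →
        (⟨ℓ, colaxMate adj rl⟩ : ColaxData SA SB).IsColaxMorphism) ∧
    (∀ lc : ∀ (X : 𝒜) (f : J.obj X ⟶ CA),
        (SA.ext X).obj f ≫ ℓ ⟶ (SB.ext X).obj (f ≫ ℓ),
      (⟨ℓ, lc⟩ : ColaxData SA SB).IsColaxMorphism →
        (⟨r, laxMate adj lc⟩ : LaxData SB SA).IsLaxMorphism) ∧
    (∀ rl : ∀ (X : 𝒜) (g : J.obj X ⟶ CB),
        (SA.ext X).obj (g ≫ r) ⟶ (SB.ext X).obj g ≫ r,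
      (⟨r, rl⟩ : LaxData SB SA).IsLaxMorphism →
        laxMate adj (colaxMate adj rl) = rl) ∧
    (∀ lc : ∀ (X : 𝒜) (f : J.obj X ⟶ CA),
        (SA.ext X).obj f ≫ ℓ ⟶ (SB.ext X).obj (f ≫ ℓ),
      (⟨ℓ, lc⟩ : ColaxData SA SB).IsColaxMorphism →
        colaxMate adj (laxMate adj lc) = lc) := by
  exact ⟨fun _ h => h.colaxMate adj hA, fun _ h => h.laxMate adj hB,
    fun rl h => laxMate_colaxMate adj rl h, fun lc h => colaxMate_laxMate adj lc h⟩
end
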